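/- arXiv:1609.08162 — 7 statements merged into one kernel-verified Lean document; each statement's English description precedes it below -/
import Mathlib

section
/- Let $k$ be an infinite field. Give $k[x,y,z,w,v]$ the $\mathbb{N}^3$-weighting $x \mapsto (1,0,0)$, $y \mapsto (0,1,0)$, $z \mapsto (0,0,1)$, $w \mapsto (1,1,0)$, $v \mapsto (1,1,1)$. Then for every $n \in \mathbb{N}$ and every polynomial $f \in k[x,y,z,w,v]$ that is weighted homogeneous of degree $(n,n,n)$, the set $\{p \in k^5 : v(p) \neq 0 \text{ and } f(p) = 0\}$ is not equal to the set $\{p \in k^5 : v(p) \neq 0 \text{ and } x(p) = 0\}$. -/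
open MvPolynomial

/-- The `ℕ³`-weighting on `k[x,y,z,w,v]`: `x ↦ (1,0,0)`, `y ↦ (0,1,0)`,
`z ↦ (0,0,1)`, `w ↦ (1,1,0)`, `v ↦ (1,1,1)`. -/
def stmt6Weight : Fin 5 → ℕ × ℕ × ℕ := ![(1,0,0), (0,1,0), (0,0,1), (1,1,0), (1,1,1)]

/-- For an infinite field `k` and any polynomial `f ∈ k[x,y,z,w,v]` which is
weighted homogeneous of degree `(n,n,n)`, the locus `{v ≠ 0, f = 0}` in `k⁵`
is never equal to the locus `{v ≠ 0, x = 0}`. -/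
theorem stmt6 (k : Type) [Field k] [Infinite k] (n : ℕ) (f : MvPolynomial (Fin 5) k)
    (hf : f.IsWeightedHomogeneous stmt6Weight (n, n, n)) :
    {p : Fin 5 → k | eval p (X 4 : MvPolynomial (Fin 5) k) ≠ 0 ∧ eval p f = 0} ≠
      {p : Fin 5 → k | eval p (X 4 : MvPolynomial (Fin 5) k) ≠ 0 ∧
        eval p (X 0 : MvPolynomial (Fin 5) k) = 0} := by
  intro h
  -- every monomial of `f` has equal exponents in `x` and `y`,
  -- so `f` takes the same value at `(1,0,0,0,1)` and `(0,0,0,0,1)`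
  have key : eval (![1, 0, 0, 0, 1] : Fin 5 → k) f = eval (![0, 0, 0, 0, 1] : Fin 5 → k) f := by
    rw [eval_eq', eval_eq']
    refine Finset.sum_congr rfl fun d hd => ?_
    have hw := hf (mem_support_iff.mp hd)
    rw [Finsupp.weight_apply, Finsupp.sum_fintype _ _ (by simp)] at hw
    simp [Fin.sum_univ_five, stmt6Weight, Prod.ext_iff] at hw
    have hab : d 0 = d 1 := by
      omega
    congr 1
    simp [Fin.prod_univ_five, hab]
    by_cases h1 : d 1 = 0 <;> simp [h1]
  have h0 := (Set.ext_iff.mp h ![0, 0, 0, 0, 1]).mpr (by simp)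
  have h1 := (Set.ext_iff.mp h ![1, 0, 0, 0, 1]).mp ⟨by simp, key.trans h0.2⟩
  simp at h1
end

section
/- Let $R = \mathbb{Z}[s,t]/\big(t(s+t),\, s^2(s+t)\big)$. Then $(s+t)^3 = 0$ in $R$, $s(s+t) = (s+t)^2$ in $R$, and the ring homomorphism $\mathbb{Z}[x]/(x^3) \to R$ sending $x$ to the class of $s+t$ is well-defined and injective. -/
open MvPolynomial

/-- The ideal `(t(s+t), s²(s+t))` of `ℤ[s,t]`, where `s = X 0`, `t = X 1`. -/
noncomputable def stmt7I : Ideal (MvPolynomial (Fin 2) ℤ) :=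
  Ideal.span {X 1 * (X 0 + X 1), (X 0) ^ 2 * (X 0 + X 1)}

/-- The ring `R = ℤ[s,t]/(t(s+t), s²(s+t))`. -/
noncomputable abbrev stmt7R := MvPolynomial (Fin 2) ℤ ⧸ stmt7I

/-- In `R = ℤ[s,t]/(t(s+t), s²(s+t))` one has `(s+t)³ = 0` and
`s(s+t) = (s+t)²`, and there is a (necessarily unique) ring homomorphism
`ℤ[x]/(x³) → R` sending (the class of) `x` to the class of `s+t`;
moreover this homomorphism is injective. -/
theorem stmt7 :
    (Ideal.Quotient.mk stmt7I (X 0 + X 1)) ^ 3 = 0 ∧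
    Ideal.Quotient.mk stmt7I (X 0 * (X 0 + X 1)) =
      (Ideal.Quotient.mk stmt7I (X 0 + X 1)) ^ 2 ∧
    ∃ ψ : (Polynomial ℤ ⧸ Ideal.span ({Polynomial.X ^ 3} : Set (Polynomial ℤ))) →+* stmt7R,
      ψ (Ideal.Quotient.mk _ Polynomial.X) = Ideal.Quotient.mk stmt7I (X 0 + X 1) ∧
      Function.Injective ψ := by
  have h1 : Ideal.Quotient.mk stmt7I (X 1 * (X 0 + X 1)) = 0 :=
    Ideal.Quotient.eq_zero_iff_mem.mpr (Ideal.subset_span (by simp))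
  have h2 : Ideal.Quotient.mk stmt7I ((X 0) ^ 2 * (X 0 + X 1)) = 0 :=
    Ideal.Quotient.eq_zero_iff_mem.mpr (Ideal.subset_span (by simp))
  have h3 : (Ideal.Quotient.mk stmt7I (X 0 + X 1)) ^ 3 = 0 := by
    have e : (X 0 + X 1 : MvPolynomial (Fin 2) ℤ) ^ 3
        = (X 0) ^ 2 * (X 0 + X 1) + (X 1 * (X 0 + X 1)) * (2 * X 0 + X 1) := by ring
    rw [← map_pow, e, map_add, map_mul _ (X 1 * (X 0 + X 1)), h1, h2]
    simp
  refine ⟨h3, ?_, ?_⟩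
  · have e : (X 0 + X 1 : MvPolynomial (Fin 2) ℤ) ^ 2
        = X 0 * (X 0 + X 1) + X 1 * (X 0 + X 1) := by ring
    rw [← map_pow, e, map_add, h1, add_zero]
  · let J : Ideal (Polynomial ℤ) := Ideal.span ({Polynomial.X ^ 3} : Set (Polynomial ℤ))
    let f : Polynomial ℤ →+* stmt7R :=
      Polynomial.eval₂RingHom (Int.castRingHom stmt7R) (Ideal.Quotient.mk stmt7I (X 0 + X 1))
    have hfX : f Polynomial.X = Ideal.Quotient.mk stmt7I (X 0 + X 1) := by simp [f]
    have hf : ∀ a ∈ J, f a = 0 := by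
      intro a ha
      obtain ⟨b, rfl⟩ := Ideal.mem_span_singleton.mp ha
      rw [map_mul, map_pow, hfX, h3, zero_mul]
    have hx3 : (Ideal.Quotient.mk J Polynomial.X) ^ 3 = 0 := by
      rw [← map_pow]
      exact Ideal.Quotient.eq_zero_iff_mem.mpr (Ideal.mem_span_singleton_self _)
    -- the retraction `s ↦ x`, `t ↦ 0`
    let g : MvPolynomial (Fin 2) ℤ →+* (Polynomial ℤ ⧸ J) :=
      MvPolynomial.eval₂Hom (Int.castRingHom _) ![Ideal.Quotient.mk J Polynomial.X, 0]
    have hg0 : g (X 0) = Ideal.Quotient.mk J Polynomial.X := by simp [g]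
    have hg1 : g (X 1) = 0 := by simp [g]
    have hg : stmt7I ≤ RingHom.ker g := by
      refine Ideal.span_le.mpr ?_
      rintro a (rfl | rfl)
      · change g _ = 0
        rw [map_mul, hg1, zero_mul]
      · change g _ = 0
        rw [map_mul, map_pow, map_add, hg1, hg0, add_zero, ← pow_succ, hx3]
    let G : stmt7R →+* (Polynomial ℤ ⧸ J) := Ideal.Quotient.lift stmt7I g hg
    refine ⟨Ideal.Quotient.lift J f hf, ?_, ?_⟩
    · exact hfX
    · have hc : G.comp (Ideal.Quotient.lift J f hf) = RingHom.id _ := by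
        apply Ideal.Quotient.ringHom_ext
        apply Polynomial.ringHom_ext
        · intro a
          simp
        · change G (f Polynomial.X) = Ideal.Quotient.mk J Polynomial.X
          rw [hfX]
          change g _ = _
          rw [map_add, hg0, hg1, add_zero]
      exact Function.LeftInverse.injective (g := G) (fun a => RingHom.congr_fun hc a)
end

section
/- Let $R = \mathbb{Z}[s,t]/\big(t(s+t),\, s^2(s+t)\big)$. Then for every $n \in \mathbb{N}$, the class of $t^n$ is nonzero in $R$; in particular $R$ is not finitely generated as an abelian group. -/
open MvPolynomial

/-- The ideal `(t(s+t), s²(s+t))` of `ℤ[s,t]`, where `s = X 0`, `t = X 1`. -/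
noncomputable def stmt8I : Ideal (MvPolynomial (Fin 2) ℤ) :=
  Ideal.span {X 1 * (X 0 + X 1), (X 0) ^ 2 * (X 0 + X 1)}

/-- The ring `R = ℤ[s,t]/(t(s+t), s²(s+t))`. -/
noncomputable abbrev stmt8R := MvPolynomial (Fin 2) ℤ ⧸ stmt8I

/-- The ring map `R → ℤ[x]`, `s ↦ -x`, `t ↦ x`. -/
noncomputable def stmt8Map : stmt8R →+* Polynomial ℤ :=
  Ideal.Quotient.lift stmt8I
    (aeval ![-Polynomial.X, (Polynomial.X : Polynomial ℤ)] :
      MvPolynomial (Fin 2) ℤ →ₐ[ℤ] Polynomial ℤ).toRingHom (by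
    intro a ha
    have h : stmt8I ≤ RingHom.ker
        (aeval ![-Polynomial.X, (Polynomial.X : Polynomial ℤ)] :
          MvPolynomial (Fin 2) ℤ →ₐ[ℤ] Polynomial ℤ).toRingHom := by
      unfold stmt8I
      rw [Ideal.span_le]
      rintro x (rfl | rfl) <;> simp [RingHom.mem_ker]
    exact h ha)

theorem stmt8Map_t :
    stmt8Map (Ideal.Quotient.mk stmt8I (X 1 : MvPolynomial (Fin 2) ℤ)) = Polynomial.X := by
  simp [stmt8Map]

theorem stmt8Map_surjective : Function.Surjective stmt8Map := by
  intro p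
  refine ⟨p.eval₂ (Int.castRingHom stmt8R)
    (Ideal.Quotient.mk stmt8I (X 1 : MvPolynomial (Fin 2) ℤ)), ?_⟩
  rw [Polynomial.hom_eval₂, stmt8Map_t,
    RingHom.ext_int (stmt8Map.comp (Int.castRingHom stmt8R)) Polynomial.C]
  exact Polynomial.eval₂_C_X

/-- In `R = ℤ[s,t]/(t(s+t), s²(s+t))` the class of `tⁿ` is nonzero for every
`n`, and `R` is not finitely generated as an abelian group. -/
theorem stmt8 :
    (∀ n : ℕ, Ideal.Quotient.mk stmt8I ((X 1 : MvPolynomial (Fin 2) ℤ) ^ n) ≠ 0) ∧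
    ¬ AddGroup.FG stmt8R := by
  constructor
  · intro n hn
    have h := congrArg stmt8Map hn
    rw [map_pow, map_pow, stmt8Map_t, map_zero] at h
    exact pow_ne_zero n Polynomial.X_ne_zero h
  · intro h
    have h1 : AddGroup.FG (Polynomial ℤ) :=
      AddGroup.fg_of_surjective (f := stmt8Map.toAddMonoidHom) stmt8Map_surjective
    have h2 : Module.Finite ℤ (Polynomial ℤ) := Module.Finite.iff_addGroup_fg.mpr h1
    exact Polynomial.not_finite h2
end

section
/- Let $R = \mathbb{Z}[s,t]/\big(s^2(s+t),\, t^2(s+t)\big)$. Then the ring homomorphism $\mathbb{Z}[a,b,c]/\big(a^2-(b+c),\, ab-ac,\, bc,\, b^2\big) \to R$ sending $a$ to the class of $s+t$, $b$ to the class of $t(s+t)$, and $c$ to the class of $s(s+t)$ is well-defined and injective. -/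
open MvPolynomial

/-- The ideal `(s²(s+t), t²(s+t))` of `ℤ[s,t]`, where `s = X 0`, `t = X 1`. -/
noncomputable def stmt9I : Ideal (MvPolynomial (Fin 2) ℤ) :=
  Ideal.span {(X 0) ^ 2 * (X 0 + X 1), (X 1) ^ 2 * (X 0 + X 1)}

/-- The ring `R = ℤ[s,t]/(s²(s+t), t²(s+t))`. -/
noncomputable abbrev stmt9R := MvPolynomial (Fin 2) ℤ ⧸ stmt9I

/-- The ideal `(a² - (b+c), ab - ac, bc, b²)` of `ℤ[a,b,c]`, where
`a = X 0`, `b = X 1`, `c = X 2`. -/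
noncomputable def stmt9J : Ideal (MvPolynomial (Fin 3) ℤ) :=
  Ideal.span {(X 0) ^ 2 - (X 1 + X 2), X 0 * X 1 - X 0 * X 2, X 1 * X 2, (X 1) ^ 2}


theorem stmt9_normal (p : MvPolynomial (Fin 3) ℤ) :
    ∃ n0 n1 n2 n3 n4 : ℤ,
      Ideal.Quotient.mk stmt9J p = Ideal.Quotient.mk stmt9J
        (C n0 + C n1 * X 0 + C n2 * X 1 + C n3 * X 2 + C n4 * (X 0 * X 1)) := by
  have h1 : Ideal.Quotient.mk stmt9J ((X 0) ^ 2 - (X 1 + X 2)) = 0 :=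
    Ideal.Quotient.eq_zero_iff_mem.2 (Ideal.subset_span (by simp))
  have h2 : Ideal.Quotient.mk stmt9J (X 0 * X 1 - X 0 * X 2) = 0 :=
    Ideal.Quotient.eq_zero_iff_mem.2 (Ideal.subset_span (by simp))
  have h3 : Ideal.Quotient.mk stmt9J (X 1 * X 2) = 0 :=
    Ideal.Quotient.eq_zero_iff_mem.2 (Ideal.subset_span (by simp))
  have h4 : Ideal.Quotient.mk stmt9J ((X 1) ^ 2) = 0 :=
    Ideal.Quotient.eq_zero_iff_mem.2 (Ideal.subset_span (by simp))
  simp only [map_sub, map_add, map_mul, map_pow] at h1 h2 h3 h4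
  induction p using MvPolynomial.induction_on with
  | C n => exact ⟨n, 0, 0, 0, 0, by simp⟩
  | add p q hp hq =>
    obtain ⟨a0, a1, a2, a3, a4, ha⟩ := hp
    obtain ⟨b0, b1, b2, b3, b4, hb⟩ := hq
    refine ⟨a0 + b0, a1 + b1, a2 + b2, a3 + b3, a4 + b4, ?_⟩
    rw [map_add, ha, hb, ← map_add]
    congr 1
    simp only [map_add]
    ring
  | mul_X p i hp =>
    obtain ⟨n0, n1, n2, n3, n4, hp⟩ := hp
    rw [map_mul, hp]
    fin_cases i
    · refine ⟨0, n0, n1, n1, n2 + n3, ?_⟩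
      simp only [map_add, map_mul, map_zero, Fin.zero_eta, Fin.isValue]
      generalize Ideal.Quotient.mk stmt9J (X 0) = a at *
      generalize Ideal.Quotient.mk stmt9J (X 1) = b at *
      generalize Ideal.Quotient.mk stmt9J (X 2) = c at *
      generalize Ideal.Quotient.mk stmt9J (C n0) = m0 at *
      generalize Ideal.Quotient.mk stmt9J (C n1) = m1 at *
      generalize Ideal.Quotient.mk stmt9J (C n2) = m2 at *
      generalize Ideal.Quotient.mk stmt9J (C n3) = m3 at *
      generalize Ideal.Quotient.mk stmt9J (C n4) = m4 at *
      linear_combination (m1 + m4 * b) * h1 - m3 * h2 + m4 * h3 + m4 * h4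
    · refine ⟨0, 0, n0, 0, n1, ?_⟩
      simp only [map_add, map_mul, map_zero, Fin.mk_one, Fin.isValue]
      linear_combination (Ideal.Quotient.mk stmt9J (C n2) + Ideal.Quotient.mk stmt9J (C n4) * Ideal.Quotient.mk stmt9J (X 0)) * h4 + Ideal.Quotient.mk stmt9J (C n3) * h3
    · refine ⟨0, 0, 0, n0, n1, ?_⟩
      simp only [map_add, map_mul, map_zero, Fin.reduceFinMk, Fin.isValue]
      generalize Ideal.Quotient.mk stmt9J (X 0) = a at *
      generalize Ideal.Quotient.mk stmt9J (X 1) = b at *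
      generalize Ideal.Quotient.mk stmt9J (X 2) = c at *
      generalize Ideal.Quotient.mk stmt9J (C n0) = m0 at *
      generalize Ideal.Quotient.mk stmt9J (C n1) = m1 at *
      generalize Ideal.Quotient.mk stmt9J (C n2) = m2 at *
      generalize Ideal.Quotient.mk stmt9J (C n3) = m3 at *
      generalize Ideal.Quotient.mk stmt9J (C n4) = m4 at *
      have hc : c ^ 2 = 0 := by
        linear_combination (b - c) * h1 - a * h2 + h4
      linear_combination (- m1) * h2 + m2 * h3 + m3 * hc + m4 * a * h3

theorem stmt9_indep (n0 n1 n2 n3 n4 : ℤ)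
    (h : (C n0 + C n1 * (X 0 + X 1) + C n2 * (X 1 * (X 0 + X 1)) + C n3 * (X 0 * (X 0 + X 1))
      + C n4 * ((X 0 + X 1) * (X 1 * (X 0 + X 1))) : MvPolynomial (Fin 2) ℤ) ∈ stmt9I) :
    n0 = 0 ∧ n1 = 0 ∧ n2 = 0 ∧ n3 = 0 ∧ n4 = 0 := by
  obtain ⟨p, q, h⟩ := Ideal.mem_span_pair.1 h
  have h' := congrArg (MvPolynomial.aeval
    ![(Polynomial.C Polynomial.X : Polynomial (Polynomial ℤ)), Polynomial.X]) h
  simp only [map_add, map_mul, map_pow, aeval_X, Matrix.cons_val_zero, Matrix.cons_val_one,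
    algHom_C, Fin.isValue] at h'
  generalize (MvPolynomial.aeval
    ![(Polynomial.C Polynomial.X : Polynomial (Polynomial ℤ)), Polynomial.X]) p = P at h'
  generalize (MvPolynomial.aeval
    ![(Polynomial.C Polynomial.X : Polynomial (Polynomial ℤ)), Polynomial.X]) q = Q at h'
  have e : ∀ n : ℤ, algebraMap ℤ (Polynomial (Polynomial ℤ)) n
      = Polynomial.C (Polynomial.C n) := fun n => by simp
  simp only [e] at h'
  have h'' : P * Polynomial.C (Polynomial.X ^ 3)
      + P * Polynomial.C (Polynomial.X ^ 2) * Polynomial.X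
      + Q * Polynomial.C Polynomial.X * Polynomial.X ^ 2 + Q * Polynomial.X ^ 3
      = Polynomial.C (Polynomial.C n0 + Polynomial.C n1 * Polynomial.X
          + Polynomial.C n3 * Polynomial.X ^ 2)
        + Polynomial.C (Polynomial.C n1 + Polynomial.C (n2 + n3) * Polynomial.X
          + Polynomial.C n4 * Polynomial.X ^ 2) * Polynomial.X
        + Polynomial.C (Polynomial.C n2 + Polynomial.C (2 * n4) * Polynomial.X)
          * Polynomial.X ^ 2
        + Polynomial.C (Polynomial.C n4) * Polynomial.X ^ 3 := by
    simp only [map_add, map_mul, map_pow, map_ofNat] at h' ⊢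
    linear_combination h'
  have c (i j : ℕ) := congrArg (fun f => Polynomial.coeff (Polynomial.coeff f i) j) h''
  have c00 := c 0 0
  have c10 := c 0 1
  have c20 := c 0 2
  have c30 := c 0 3
  have c02 := c 2 0
  have c21 := c 1 2
  clear c h h' h''
  simp [Polynomial.coeff_X, Polynomial.coeff_C, Polynomial.coeff_mul_X_pow', Polynomial.coeff_X_pow, Polynomial.coeff_mul_X,
    ← map_pow, -Polynomial.C_pow, ← map_mul, -Polynomial.C_mul, ← map_add, -Polynomial.C_add] at c00 c10 c20 c30 c02 c21
  have k : ∀ (n : ℤ) (j : ℕ), j ≠ 0 → ((n : Polynomial ℤ)).coeff j = 0 := by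
    intro n j hj
    rw [← eq_intCast (Polynomial.C : ℤ →+* Polynomial ℤ), Polynomial.coeff_C, if_neg hj]
  rw [k _ _ (by norm_num)] at c10
  rw [k _ _ (by norm_num), k _ _ (by norm_num)] at c20
  rw [k _ _ (by norm_num), k _ _ (by norm_num), k _ _ (by norm_num)] at c30
  rw [k _ _ (by norm_num), k _ _ (by norm_num), k _ _ (by norm_num)] at c21
  omega

/-- There is a (necessarily unique) ring homomorphism
`ℤ[a,b,c]/(a² - (b+c), ab - ac, bc, b²) → R = ℤ[s,t]/(s²(s+t), t²(s+t))`
sending `a ↦ s+t`, `b ↦ t(s+t)`, `c ↦ s(s+t)`, and it is injective. -/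
theorem stmt9 :
    ∃ ψ : (MvPolynomial (Fin 3) ℤ ⧸ stmt9J) →+* stmt9R,
      ψ (Ideal.Quotient.mk stmt9J (X 0)) = Ideal.Quotient.mk stmt9I (X 0 + X 1) ∧
      ψ (Ideal.Quotient.mk stmt9J (X 1)) = Ideal.Quotient.mk stmt9I (X 1 * (X 0 + X 1)) ∧
      ψ (Ideal.Quotient.mk stmt9J (X 2)) = Ideal.Quotient.mk stmt9I (X 0 * (X 0 + X 1)) ∧
      Function.Injective ψ := by
  let f : MvPolynomial (Fin 3) ℤ →+* MvPolynomial (Fin 2) ℤ :=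
    (MvPolynomial.aeval ![X 0 + X 1, X 1 * (X 0 + X 1), X 0 * (X 0 + X 1)]).toRingHom
  have f0 : f (X 0) = X 0 + X 1 := by simp [f]
  have f1 : f (X 1) = X 1 * (X 0 + X 1) := by simp [f]
  have f2 : f (X 2) = X 0 * (X 0 + X 1) := by simp [f]
  have fC (n : ℤ) : f (C n) = C n := by simp [f]
  clear_value f
  have hle : stmt9J ≤ stmt9I.comap f := by
    unfold stmt9J
    rw [Ideal.span_le]
    intro x hx
    simp only [Set.mem_insert_iff, Set.mem_singleton_iff] at hx
    simp only [SetLike.mem_coe, Ideal.mem_comap, stmt9I]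
    rw [Ideal.mem_span_pair]
    rcases hx with rfl | rfl | rfl | rfl
    · exact ⟨0, 0, by simp only [map_sub, map_add, map_mul, map_pow, f0, f1, f2]; ring⟩
    · exact ⟨-1, 1, by simp only [map_sub, map_add, map_mul, map_pow, f0, f1, f2]; ring⟩
    · exact ⟨X 1, X 0, by simp only [map_sub, map_add, map_mul, map_pow, f0, f1, f2]; ring⟩
    · exact ⟨0, X 0 + X 1, by simp only [map_sub, map_add, map_mul, map_pow, f0, f1, f2]; ring⟩
  refine ⟨Ideal.quotientMap stmt9I f hle, ?_, ?_, ?_, ?_⟩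
  · rw [Ideal.quotientMap_mk, f0]
  · rw [Ideal.quotientMap_mk, f1]
  · rw [Ideal.quotientMap_mk, f2]
  · rw [injective_iff_map_eq_zero]
    intro x hx
    obtain ⟨p, rfl⟩ := Ideal.Quotient.mk_surjective x
    obtain ⟨n0, n1, n2, n3, n4, hp⟩ := stmt9_normal p
    rw [hp] at hx ⊢
    rw [Ideal.quotientMap_mk, Ideal.Quotient.eq_zero_iff_mem] at hx
    simp only [map_add, map_mul, f0, f1, f2, fC] at hx
    obtain ⟨rfl, rfl, rfl, rfl, rfl⟩ := stmt9_indep n0 n1 n2 n3 n4 hx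
    simp
end

section
/- Let $R = \mathbb{Z}[s,t]/\big(s^2(s+t),\, t^2(s+t)\big)$. Then in $R$: (i) $t(s+t) \neq s(s+t)$; (ii) $(s+t)\cdot t(s+t) = st(s+t) = (s+t)\cdot s(s+t)$; and (iii) $st(s+t) \neq 0$. -/
open MvPolynomial

/-- The ideal `(s²(s+t), t²(s+t))` of `ℤ[s,t]`, where `s = X 0`, `t = X 1`. -/
noncomputable def stmt10I : Ideal (MvPolynomial (Fin 2) ℤ) :=
  Ideal.span {(X 0) ^ 2 * (X 0 + X 1), (X 1) ^ 2 * (X 0 + X 1)}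

theorem stmt10_aux (p : MvPolynomial (Fin 2) ℤ) (h : p * (X 0 + X 1) ∈ stmt10I) :
    ∃ a b : MvPolynomial (Fin 2) ℤ, a * X 0 ^ 2 + b * X 1 ^ 2 = p := by
  obtain ⟨a, b, hab⟩ := Ideal.mem_span_pair.1 h
  refine ⟨a, b, ?_⟩
  have hne : (X 0 + X 1 : MvPolynomial (Fin 2) ℤ) ≠ 0 := by
    intro h0
    have := congrArg (MvPolynomial.eval (fun _ => (1 : ℤ))) h0
    simp at this
  apply mul_right_cancel₀ hne
  rw [← hab]
  ring

/-- In `R = ℤ[s,t]/(s²(s+t), t²(s+t))` one has: (i) `t(s+t) ≠ s(s+t)`;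
(ii) `(s+t)·t(s+t) = st(s+t) = (s+t)·s(s+t)`; and (iii) `st(s+t) ≠ 0`. -/
theorem stmt10 :
    Ideal.Quotient.mk stmt10I (X 1 * (X 0 + X 1)) ≠
      Ideal.Quotient.mk stmt10I (X 0 * (X 0 + X 1)) ∧
    Ideal.Quotient.mk stmt10I ((X 0 + X 1) * (X 1 * (X 0 + X 1))) =
      Ideal.Quotient.mk stmt10I (X 0 * X 1 * (X 0 + X 1)) ∧
    Ideal.Quotient.mk stmt10I (X 0 * X 1 * (X 0 + X 1)) =
      Ideal.Quotient.mk stmt10I ((X 0 + X 1) * (X 0 * (X 0 + X 1))) ∧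
    Ideal.Quotient.mk stmt10I (X 0 * X 1 * (X 0 + X 1)) ≠ 0 := by
  refine ⟨?_, ?_, ?_, ?_⟩
  · intro h
    rw [Ideal.Quotient.eq, ← sub_mul] at h
    obtain ⟨a, b, hab⟩ := stmt10_aux _ h
    have := congrArg (MvPolynomial.eval ![(0 : ℤ), 2]) hab
    simp at this
    omega
  · rw [Ideal.Quotient.eq]
    exact Ideal.mem_span_pair.2 ⟨0, 1, by ring⟩
  · rw [Ideal.Quotient.eq]
    exact Ideal.mem_span_pair.2 ⟨-1, 0, by ring⟩
  · intro h
    rw [Ideal.Quotient.eq_zero_iff_mem] at h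
    obtain ⟨a, b, hab⟩ := stmt10_aux _ h
    have h2 := congrArg (MvPolynomial.aeval (R := ℤ)
      ![(TrivSqZeroExt.inl DualNumber.eps : DualNumber (DualNumber ℤ)), DualNumber.eps]) hab
    have h3 := congrArg (fun z => TrivSqZeroExt.snd (TrivSqZeroExt.snd z)) h2
    simp [pow_two, ← TrivSqZeroExt.inl_mul] at h3
end

section
/- Let $R = \mathbb{Z}[s,t,u]/\big(u(s+t+u),\, s(s+t)(s+t+u),\, t(s+t)(s+t+u)\big)$. Then $(s+t+u)^3 = 0$ in $R$, and the ring homomorphism $\mathbb{Z}[x]/(x^3) \to R$ sending $x$ to the class of $s+t+u$ is well-defined and injective. -/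
open MvPolynomial

/-- The ideal `(u(s+t+u), s(s+t)(s+t+u), t(s+t)(s+t+u))` of `ℤ[s,t,u]`, where
`s = X 0`, `t = X 1`, `u = X 2`. -/
noncomputable def stmt11I : Ideal (MvPolynomial (Fin 3) ℤ) :=
  Ideal.span {X 2 * (X 0 + X 1 + X 2),
    X 0 * (X 0 + X 1) * (X 0 + X 1 + X 2),
    X 1 * (X 0 + X 1) * (X 0 + X 1 + X 2)}

/-- The ring `R = ℤ[s,t,u]/(u(s+t+u), s(s+t)(s+t+u), t(s+t)(s+t+u))`. -/
noncomputable abbrev stmt11R := MvPolynomial (Fin 3) ℤ ⧸ stmt11I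

/-- In `R = ℤ[s,t,u]/(u(s+t+u), s(s+t)(s+t+u), t(s+t)(s+t+u))` one has
`(s+t+u)³ = 0`, and there is a (necessarily unique) ring homomorphism
`ℤ[x]/(x³) → R` sending `x` to the class of `s+t+u`; moreover it is injective. -/
theorem stmt11 :
    (Ideal.Quotient.mk stmt11I (X 0 + X 1 + X 2)) ^ 3 = 0 ∧
    ∃ ψ : (Polynomial ℤ ⧸ Ideal.span ({Polynomial.X ^ 3} : Set (Polynomial ℤ))) →+* stmt11R,
      ψ (Ideal.Quotient.mk _ Polynomial.X) = Ideal.Quotient.mk stmt11I (X 0 + X 1 + X 2) ∧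
      Function.Injective ψ := by
  have h3 : (Ideal.Quotient.mk stmt11I (X 0 + X 1 + X 2)) ^ 3 = 0 := by
    rw [← map_pow, Ideal.Quotient.eq_zero_iff_mem]
    have e : (X 0 + X 1 + X 2 : MvPolynomial (Fin 3) ℤ) ^ 3
        = (X 0 + X 1 + X 2 + (X 0 + X 1)) * (X 2 * (X 0 + X 1 + X 2))
          + X 0 * (X 0 + X 1) * (X 0 + X 1 + X 2)
          + X 1 * (X 0 + X 1) * (X 0 + X 1 + X 2) := by ring
    rw [e]
    refine add_mem (add_mem (Ideal.mul_mem_left _ _ ?_) ?_) ?_ <;>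
      exact Ideal.subset_span (by simp)
  refine ⟨h3, Ideal.Quotient.lift _
    (Polynomial.eval₂RingHom (Int.castRingHom stmt11R)
      (Ideal.Quotient.mk stmt11I (X 0 + X 1 + X 2))) ?_, ?_, ?_⟩
  · intro a ha
    obtain ⟨b, rfl⟩ := Ideal.mem_span_singleton.1 ha
    rw [map_mul, map_pow, Polynomial.coe_eval₂RingHom, Polynomial.eval₂_X, h3, zero_mul]
  · rw [Ideal.Quotient.lift_mk, Polynomial.coe_eval₂RingHom, Polynomial.eval₂_X]
  · -- the retraction `s ↦ x`, `t ↦ 0`, `u ↦ 0`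
    let q := Ideal.Quotient.mk (Ideal.span ({Polynomial.X ^ 3} : Set (Polynomial ℤ)))
    have hq : q Polynomial.X ^ 3 = 0 := by
      rw [← map_pow]
      exact Ideal.Quotient.eq_zero_iff_mem.2 (Ideal.mem_span_singleton_self _)
    let f : MvPolynomial (Fin 3) ℤ →+* _ :=
      MvPolynomial.eval₂Hom (Int.castRingHom _) ![q Polynomial.X, 0, 0]
    have f0 : f (X 0) = q Polynomial.X := by simp [f]
    have f1 : f (X 1) = 0 := by simp [f]
    have f2 : f (X 2) = 0 := by simp [f]
    have hf : stmt11I ≤ RingHom.ker f := by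
      refine Ideal.span_le.2 ?_
      rintro p (rfl | rfl | rfl)
      · simp [RingHom.mem_ker, f2]
      · simp only [SetLike.mem_coe, RingHom.mem_ker, map_mul, map_add, f0, f1, f2, add_zero]
        rw [← hq]; ring
      · simp [RingHom.mem_ker, f1]
    let ρ : stmt11R →+* _ := Ideal.Quotient.lift stmt11I f (fun a ha => hf ha)
    refine Function.LeftInverse.injective (g := ρ) ?_
    intro y
    refine RingHom.congr_fun (f := ρ.comp _) (g := RingHom.id _) ?_ y
    refine Ideal.Quotient.ringHom_ext (Polynomial.ringHom_ext' (RingHom.ext_int _ _) ?_)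
    simp only [RingHom.comp_apply, Ideal.Quotient.lift_mk, Polynomial.coe_eval₂RingHom,
      Polynomial.eval₂_X, RingHom.id_apply]
    have hρ : ∀ p, ρ (Ideal.Quotient.mk stmt11I p) = f p := fun p => rfl
    refine (hρ _).trans ?_
    rw [map_add, map_add, f0, f1, f2, add_zero, add_zero]
end

section
/- Let $R = \mathbb{Z}[s,t,u]/\big(u(s+t+u),\, s(s+t)(s+t+u),\, t(s+t)(s+t+u)\big)$. Then for every $n \in \mathbb{N}$, the class of $s^n$ is nonzero in $R$; in particular $R$ is not finitely generated as an abelian group. -/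
open MvPolynomial

/-- The ideal `(u(s+t+u), s(s+t)(s+t+u), t(s+t)(s+t+u))` of `ℤ[s,t,u]`, where
`s = X 0`, `t = X 1`, `u = X 2`. -/
noncomputable def stmt13I : Ideal (MvPolynomial (Fin 3) ℤ) :=
  Ideal.span {X 2 * (X 0 + X 1 + X 2),
    X 0 * (X 0 + X 1) * (X 0 + X 1 + X 2),
    X 1 * (X 0 + X 1) * (X 0 + X 1 + X 2)}

/-- The ring `R = ℤ[s,t,u]/(u(s+t+u), s(s+t)(s+t+u), t(s+t)(s+t+u))`. -/
noncomputable abbrev stmt13R := MvPolynomial (Fin 3) ℤ ⧸ stmt13I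

/-- The specialization `s ↦ X, t ↦ -X, u ↦ 0`, which kills the ideal. -/
noncomputable def stmt13ev : MvPolynomial (Fin 3) ℤ →+* Polynomial ℤ :=
  (MvPolynomial.aeval (![Polynomial.X, -Polynomial.X, 0] : Fin 3 → Polynomial ℤ)).toRingHom

lemma stmt13ev_zero : stmt13ev (X 0) = Polynomial.X := by
  simp [stmt13ev]

lemma stmt13ev_ker : ∀ a ∈ stmt13I, stmt13ev a = 0 := by
  intro a ha
  have h : stmt13I ≤ RingHom.ker stmt13ev := by
    unfold stmt13I
    rw [Ideal.span_le]
    rintro x (rfl | rfl | rfl) <;> simp [stmt13ev, RingHom.mem_ker]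
  exact h ha

lemma stmt13ev_surj : Function.Surjective stmt13ev := by
  intro p
  refine ⟨Polynomial.aeval (X 0 : MvPolynomial (Fin 3) ℤ) p, ?_⟩
  have := Polynomial.hom_eval₂ p (algebraMap ℤ (MvPolynomial (Fin 3) ℤ)) stmt13ev (X 0)
  rw [Polynomial.aeval_def, this, stmt13ev_zero]
  rw [RingHom.ext_int (stmt13ev.comp _) Polynomial.C, Polynomial.eval₂_C_X]

/-- In `R = ℤ[s,t,u]/(u(s+t+u), s(s+t)(s+t+u), t(s+t)(s+t+u))` the class of
`sⁿ` is nonzero for every `n`, and `R` is not finitely generated as an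
abelian group. -/
theorem stmt13 :
    (∀ n : ℕ, Ideal.Quotient.mk stmt13I ((X 0 : MvPolynomial (Fin 3) ℤ) ^ n) ≠ 0) ∧
    ¬ AddGroup.FG stmt13R := by
  refine ⟨fun n h => ?_, fun h => ?_⟩
  · have h1 := stmt13ev_ker _ (Ideal.Quotient.eq_zero_iff_mem.mp h)
    rw [map_pow, stmt13ev_zero] at h1
    exact pow_ne_zero n Polynomial.X_ne_zero h1
  · have hs : Function.Surjective (Ideal.Quotient.lift stmt13I stmt13ev stmt13ev_ker) :=
      Ideal.Quotient.lift_surjective_of_surjective _ _ stmt13ev_surj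
    have h1 : Module.Finite ℤ stmt13R := Module.Finite.iff_addGroup_fg.mpr h
    have h2 : Module.Finite ℤ (Polynomial ℤ) :=
      Module.Finite.of_surjective
        (Ideal.Quotient.lift stmt13I stmt13ev stmt13ev_ker).toAddMonoidHom.toIntLinearMap hs
    exact Polynomial.not_finite h2
end
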